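/- Every typing ⊢{c}Γ derived by the dependency type system is sound: for all stores σ, ρ, if ⟨c,σ⟩ ⇒t_a,* ⟨c_σ,σ'⟩ →(a,v,p), ⟨c,ρ⟩ ⇒t'_a,* ⟨c_ρ,ρ'⟩ ⇒v'_a,1, |t| = |t'|, and σ ≡_{Γ(a_p)} ρ, then v = v'. -/

import Mathlib

/-- Program variables. -/
abbrev PVar := String
/-- Channels. -/
abbrev Chan := String
/-- Program points. -/
abbrev PPoint := String
/-- Values. -/
abbrev Val := ℤ
/-- Stores map program variables to values. -/
abbrev Store := PVar → Val

/-- Expressions: integer constants or variables. -/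
inductive Expr where
  | const : Val → Expr
  | var : PVar → Expr
deriving DecidableEq

def Expr.eval : Expr → Store → Val
  | .const v, _ => v
  | .var x, σ => σ x

def Expr.fv : Expr → Set PVar
  | .const _ => ∅
  | .var x => {x}

/-- Commands of the while-language with annotated outputs. -/
inductive Cmd where
  | skip : Cmd
  | seq : Cmd → Cmd → Cmd
  | assign : PVar → Expr → Cmd
  | ite : Expr → Cmd → Cmd → Cmd
  | while : Expr → Cmd → Cmd
  | out : Expr → Chan → PPoint → Cmd
deriving DecidableEq

/-- Step labels: silent, or an output (channel, value, program point). -/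
inductive Label where
  | silent : Label
  | out : Chan → Val → PPoint → Label
deriving DecidableEq

abbrev Config := Cmd × Store

/-- Small-step semantics. -/
inductive Step : Config → Label → Config → Prop where
  | skipSeq : ∀ (c : Cmd) (σ : Store), Step (.seq .skip c, σ) .silent (c, σ)
  | seq : ∀ {c₁ : Cmd} {σ : Store} {α : Label} {c₁' : Cmd} {σ' : Store} (c₂ : Cmd),
      Step (c₁, σ) α (c₁', σ') → Step (.seq c₁ c₂, σ) α (.seq c₁' c₂, σ')
  | assign : ∀ (x : PVar) (e : Expr) (σ : Store),
      Step (.assign x e, σ) .silent (.skip, Function.update σ x (e.eval σ))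
  | out : ∀ (e : Expr) (a : Chan) (p : PPoint) (σ : Store),
      Step (.out e a p, σ) (.out a (e.eval σ) p) (.skip, σ)
  | whileStep : ∀ (e : Expr) (c : Cmd) (σ : Store),
      Step (.while e c, σ) .silent (.ite e (.seq c (.while e c)) .skip, σ)
  | iteTrue : ∀ {e : Expr} {σ : Store} (c₁ c₂ : Cmd),
      e.eval σ ≠ 0 → Step (.ite e c₁ c₂, σ) .silent (c₁, σ)
  | iteFalse : ∀ {e : Expr} {σ : Store} (c₁ c₂ : Cmd),
      e.eval σ = 0 → Step (.ite e c₁ c₂, σ) .silent (c₂, σ)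

/-- Prepend a label to a list of (output) labels, dropping silent labels. -/
def Label.consTo : Label → List Label → List Label
  | .silent, ls => ls
  | l, ls => l :: ls

/-- `Steps cfg ls n cfg'`: `n` evaluation steps from `cfg` to `cfg'`, producing
the list `ls` of output labels (silent steps contribute nothing). -/
inductive Steps : Config → List Label → ℕ → Config → Prop where
  | refl : ∀ cfg, Steps cfg [] 0 cfg
  | step : ∀ {cfg : Config} {α : Label} {cfg' : Config} {ls : List Label} {n : ℕ} {cfg'' : Config},
      Step cfg α cfg' → Steps cfg' ls n cfg'' → Steps cfg (α.consTo ls) (n+1) cfg''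

/-- Projection of a label list to the values output on channel `a`. -/
def projA (a : Chan) (ls : List Label) : List Val :=
  ls.filterMap fun l => match l with
    | .silent => none
    | .out b v _ => if b = a then some v else none

/-- `⟨c,σ⟩ ⇒t_a,n ⟨c',σ'⟩`: n steps producing trace `t` of values on channel `a`. -/
def ProjSteps (cfg : Config) (a : Chan) (t : List Val) (n : ℕ) (cfg' : Config) : Prop :=
  ∃ ls, Steps cfg ls n cfg' ∧ projA a ls = t

/-- `⟨c,σ⟩ ⇒t_a`: the run of `c` from `σ` produces trace `t` on channel `a`. -/
def Produces (c : Cmd) (σ : Store) (a : Chan) (t : List Val) : Prop :=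
  ∃ n cfg', ProjSteps (c, σ) a t n cfg'

/-- A forgetful attacker: a deterministic automaton over values. -/
structure Attacker (S : Type) where
  init : S
  step : S → Val → S

/-- The attacker's state after observing trace `t`. -/
def Attacker.run {S : Type} (A : Attacker S) (t : List Val) : S :=
  t.foldl A.step A.init

/-- The counting variant `A^ω` of an attacker. -/
def Attacker.omega {S : Type} (A : Attacker S) : Attacker (S × ℕ) where
  init := (A.init, 0)
  step := fun sn v => (A.step sn.1 v, sn.2 + 1)

/-- Attacker knowledge `k(A,c,a,t)`. -/
def know {S : Type} (A : Attacker S) (c : Cmd) (a : Chan) (t : List Val) : Set Store :=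
  { ρ | ∃ t', Produces c ρ a t' ∧ A.run t' = A.run t }

/-- Exclusion knowledge `ek(A,c,a,t)`. -/
def ek {S : Type} (A : Attacker S) (c : Cmd) (a : Chan) (t : List Val) : Set Store :=
  (know A c a t)ᶜ

/-- Full progress knowledge `k#(A,c,a,t)`. -/
def kSharp {S : Type} (A : Attacker S) (c : Cmd) (a : Chan) (t : List Val) : Set Store :=
  { ρ | ∃ t' v, Produces c ρ a (t' ++ [v]) ∧ A.omega.run t' = A.omega.run t }

/-- Exclusion version `ek#(A,c,a,t)`. -/
def ekSharp {S : Type} (A : Attacker S) (c : Cmd) (a : Chan) (t : List Val) : Set Store :=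
  (kSharp A c a t)ᶜ

/-- AC progress knowledge `k⁺(A,c,a,t)`. -/
def kPlus {S : Type} (A : Attacker S) (c : Cmd) (a : Chan) (t : List Val) : Set Store :=
  { ρ | ∃ t' v, Produces c ρ a (t' ++ [v]) ∧ A.run t' = A.run t }

/-- Exclusion version `ek⁺(A,c,a,t)`. -/
def ekPlus {S : Type} (A : Attacker S) (c : Cmd) (a : Chan) (t : List Val) : Set Store :=
  (kPlus A c a t)ᶜ

/-- A dynamic policy: an equivalence relation on stores per channel and execution point. -/
structure DynPolicy where
  rel : Chan → Cmd → Store → ℕ → Store → Store → Prop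
  isEquiv : ∀ a c σ n, Equivalence (rel a c σ n)

/-- Progress-insensitive security of `c` for policy `D` against attacker `A`
on channel `a` for initial store `σ`. -/
def PISecure {S : Type} (c : Cmd) (D : DynPolicy) (A : Attacker S) (a : Chan) (σ : Store) : Prop :=
  ∀ t n c' σ' v, ProjSteps (c, σ) a t n (c', σ') →
    (∃ cfg', ProjSteps (c', σ') a [v] 1 cfg') →
    ek A c a (t ++ [v]) \ ekSharp A c a t ⊆ { ρ | ¬ D.rel a c σ n ρ σ }

/-- AC progress-insensitive security of `c` for policy `D` against attacker `A`
on channel `a` for initial store `σ`. -/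
def ACPISecure {S : Type} (c : Cmd) (D : DynPolicy) (A : Attacker S) (a : Chan) (σ : Store) : Prop :=
  ∀ t n c' σ' v, ProjSteps (c, σ) a t n (c', σ') →
    (∃ cfg', ProjSteps (c', σ') a [v] 1 cfg') →
    ek A c a (t ++ [v]) \ ekPlus A c a t ⊆ { ρ | ¬ D.rel a c σ n ρ σ }

/-- Two-run progress-insensitive security. -/
def TwoRunPISecure (c : Cmd) (D : DynPolicy) (a : Chan) (σ : Store) : Prop :=
  ∀ t n cn σn v, ProjSteps (c, σ) a t n (cn, σn) →
    (∃ cfg', ProjSteps (cn, σn) a [v] 1 cfg') →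
    ∀ ρ t' v', D.rel a c σ n ρ σ → Produces c ρ a (t' ++ [v']) → t'.length = t.length →
      v' = v

/-- A counting attacker always remembers at least how many outputs it has seen. -/
def Attacker.Counting {S : Type} (A : Attacker S) : Prop :=
  ∀ t t' : List Val, A.run t = A.run t' → t.length = t'.length

/-- A command is quasi-constant if, per channel, all its traces are prefixes of
one fixed (possibly infinite) trace. -/
def QuasiConstant (c : Cmd) : Prop :=
  ∀ a : Chan, ∃ u : ℕ → Val, ∀ σ t, Produces c σ a t →
    ∀ i : Fin t.length, t.get i = u i.val

/-- The variables of the dependency type system. -/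
inductive TVar where
  | pvar : PVar → TVar
  | cpoint : Chan → PPoint → TVar
  | pc : TVar
  | chan : Chan → TVar
deriving DecidableEq

/-- Type environments. -/
abbrev Env := TVar → Set TVar

/-- The identity environment. -/
def idEnv : Env := fun x => {x}

/-- Sequential composition of environments: `(Γ₂;Γ₁)(x) = ⋃_{y ∈ Γ₂(x)} Γ₁(y)`. -/
def envComp (Γ₂ Γ₁ : Env) : Env := fun x => ⋃ y ∈ Γ₂ x, Γ₁ y

/-- Pointwise union of environments. -/
def envUnion (Γ₁ Γ₂ : Env) : Env := fun x => Γ₁ x ∪ Γ₂ x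

/-- Iterates of an environment. -/
def envIter (Γ : Env) : ℕ → Env
  | 0 => idEnv
  | n+1 => envComp (envIter Γ n) Γ

/-- The fixed point `Γ* = ⋃_{n≥0} Γⁿ`. -/
def envStar (Γ : Env) : Env := fun x => ⋃ n, envIter Γ n x

/-- Free variables of an expression, as type-system variables. -/
def fvT (e : Expr) : Set TVar := TVar.pvar '' e.fv

/-- The dependency type system `⊢{c}Γ`. -/
inductive Typing : Cmd → Env → Prop where
  | skip : Typing .skip idEnv
  | assign : ∀ (x : PVar) (e : Expr),
      Typing (.assign x e) (Function.update idEnv (.pvar x) (fvT e ∪ {TVar.pc}))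
  | seq : ∀ {c₁ : Cmd} {Γ₁ : Env} {c₂ : Cmd} {Γ₂ : Env},
      Typing c₁ Γ₁ → Typing c₂ Γ₂ → Typing (.seq c₁ c₂) (envComp Γ₂ Γ₁)
  | ite : ∀ {e : Expr} {c₁ : Cmd} {Γ₁ : Env} {c₂ : Cmd} {Γ₂ : Env},
      Typing c₁ Γ₁ → Typing c₂ Γ₂ →
      Typing (.ite e c₁ c₂)
        (Function.update
          (envUnion (envComp Γ₁ (Function.update idEnv .pc ({TVar.pc} ∪ fvT e)))
                    (envComp Γ₂ (Function.update idEnv .pc ({TVar.pc} ∪ fvT e))))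
          .pc {TVar.pc})
  | whileT : ∀ {e : Expr} {c : Cmd} {Γc : Env}, Typing c Γc →
      Typing (.while e c)
        (Function.update
          (envStar (envComp Γc (Function.update idEnv .pc ({TVar.pc} ∪ fvT e))))
          .pc {TVar.pc})
  | out : ∀ (e : Expr) (a : Chan) (p : PPoint),
      Typing (.out e a p)
        (Function.update
          (Function.update idEnv (.cpoint a p)
            (fvT e ∪ {TVar.pc, TVar.chan a, TVar.cpoint a p}))
          (.chan a) {TVar.pc, TVar.chan a})

/-- `σ ≡_{Γ(x)} ρ`: the stores agree on all program variables in `Γ(x)`. -/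
def eqG (Γ : Env) (x : TVar) (σ ρ : Store) : Prop :=
  ∀ y : PVar, TVar.pvar y ∈ Γ x → σ y = ρ y

/-- A dynamic policy approximation: an equivalence relation on stores per
channel–program-point pair. -/
structure PolApprox where
  rel : Chan → PPoint → Store → Store → Prop
  isEquiv : ∀ a p, Equivalence (rel a p)

/-- `c : A` is a sound approximation of dynamic policy `D`. -/
def SoundApprox (c : Cmd) (A : PolApprox) (D : DynPolicy) : Prop :=
  ∀ σ n ls c' σ' a v p cfg'',
    Steps (c, σ) ls n (c', σ') → Step (c', σ') (.out a v p) cfg'' →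
    ∀ ρ₁ ρ₂, D.rel a c σ n ρ₁ ρ₂ → A.rel a p ρ₁ ρ₂


section Helpers

/-- Terminating big-step runs, counting outputs on `a`. -/
inductive Term (a : Chan) : Cmd → Store → ℕ → Store → Prop where
  | skip : ∀ σ, Term a .skip σ 0 σ
  | assign : ∀ x (e : Expr) σ, Term a (.assign x e) σ 0 (Function.update σ x (e.eval σ))
  | out : ∀ e b p σ, Term a (.out e b p) σ (if b = a then 1 else 0) σ
  | seq : ∀ {c₁ c₂ σ k₁ σ₁ k₂ σ₂}, Term a c₁ σ k₁ σ₁ → Term a c₂ σ₁ k₂ σ₂ →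
      Term a (.seq c₁ c₂) σ (k₁ + k₂) σ₂
  | iteT : ∀ {e : Expr} {c₁ c₂ σ k σ'}, e.eval σ ≠ 0 → Term a c₁ σ k σ' →
      Term a (.ite e c₁ c₂) σ k σ'
  | iteF : ∀ {e : Expr} {c₁ c₂ σ k σ'}, e.eval σ = 0 → Term a c₂ σ k σ' →
      Term a (.ite e c₁ c₂) σ k σ'
  | whileF : ∀ {e : Expr} {c σ}, e.eval σ = 0 → Term a (.while e c) σ 0 σ
  | whileT : ∀ {e : Expr} {c σ k₁ σ₁ k₂ σ₂}, e.eval σ ≠ 0 → Term a c σ k₁ σ₁ →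
      Term a (.while e c) σ₁ k₂ σ₂ → Term a (.while e c) σ (k₁ + k₂) σ₂

/-- The run reaches, after exactly `k` outputs on `a`, an output of `v` on `a` at `p`. -/
inductive Hit (a : Chan) : Cmd → Store → ℕ → Val → PPoint → Prop where
  | out : ∀ (e : Expr) p σ, Hit a (.out e a p) σ 0 (e.eval σ) p
  | seq1 : ∀ {c₁ c₂ σ k v p}, Hit a c₁ σ k v p → Hit a (.seq c₁ c₂) σ k v p
  | seq2 : ∀ {c₁ c₂ σ k₁ σ₁ k v p}, Term a c₁ σ k₁ σ₁ → Hit a c₂ σ₁ k v p →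
      Hit a (.seq c₁ c₂) σ (k₁ + k) v p
  | iteT : ∀ {e : Expr} {c₁ c₂ σ k v p}, e.eval σ ≠ 0 → Hit a c₁ σ k v p →
      Hit a (.ite e c₁ c₂) σ k v p
  | iteF : ∀ {e : Expr} {c₁ c₂ σ k v p}, e.eval σ = 0 → Hit a c₂ σ k v p →
      Hit a (.ite e c₁ c₂) σ k v p
  | while1 : ∀ {e : Expr} {c σ k v p}, e.eval σ ≠ 0 → Hit a c σ k v p →
      Hit a (.while e c) σ k v p
  | while2 : ∀ {e : Expr} {c σ k₁ σ₁ k v p}, e.eval σ ≠ 0 → Term a c σ k₁ σ₁ →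
      Hit a (.while e c) σ₁ k v p → Hit a (.while e c) σ (k₁ + k) v p

/-- Number of outputs on `a` in a label. -/
def cnt (a : Chan) : Label → ℕ
  | .silent => 0
  | .out b _ _ => if b = a then 1 else 0

theorem Term.cast {a c σ k k' σ'} (h : Term a c σ k σ') (e : k = k') : Term a c σ k' σ' := e ▸ h
theorem Hit.cast {a c σ k k' v p} (h : Hit a c σ k v p) (e : k = k') : Hit a c σ k' v p := e ▸ h

theorem step_term {a : Chan} {x : Config} {α : Label} {y : Config} (h : Step x α y) :
    ∀ k σ', Term a y.1 y.2 k σ' → Term a x.1 x.2 (cnt a α + k) σ' := by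
  induction h with
  | skipSeq c σ => intro k σ' h; exact (Term.seq (Term.skip _) h).cast (by simp [cnt])
  | seq c₂ _ ih =>
    intro k σ' h
    cases h with
    | seq h1 h2 => exact (Term.seq (ih _ _ h1) h2).cast (by simp only [Nat.add_assoc])
  | assign x e σ => intro k σ' h; cases h; exact Term.assign _ _ _
  | out e b p σ => intro k σ' h; cases h; exact Term.out _ _ _ _
  | whileStep e c σ =>
    intro k σ' h
    cases h with
    | iteT he h =>
      cases h with
      | seq h1 h2 => exact (Term.whileT he h1 h2).cast (by simp [cnt])
    | iteF he h => cases h; exact Term.whileF he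
  | iteTrue c₁ c₂ he => intro k σ' h; exact (Term.iteT he h).cast (by simp [cnt])
  | iteFalse c₁ c₂ he => intro k σ' h; exact (Term.iteF he h).cast (by simp [cnt])

theorem step_hit {a : Chan} {x : Config} {α : Label} {y : Config} (h : Step x α y) :
    ∀ k v p, Hit a y.1 y.2 k v p → Hit a x.1 x.2 (cnt a α + k) v p := by
  induction h with
  | skipSeq c σ => intro k v p h; exact (Hit.seq2 (Term.skip _) h).cast (by simp [cnt])
  | seq c₂ hs ih =>
    intro k v p h
    cases h with
    | seq1 h1 => exact Hit.seq1 (ih _ _ _ h1)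
    | seq2 h1 h2 =>
      exact (Hit.seq2 (step_term hs _ _ h1) h2).cast (by simp only [Nat.add_assoc])
  | assign x e σ => intro k v p h; cases h
  | out e b q σ => intro k v p h; cases h
  | whileStep e c σ =>
    intro k v p h
    cases h with
    | iteT he h =>
      cases h with
      | seq1 h1 => exact (Hit.while1 he h1).cast (by simp [cnt])
      | seq2 h1 h2 => exact (Hit.while2 he h1 h2).cast (by simp [cnt])
    | iteF he h => cases h
  | iteTrue c₁ c₂ he => intro k v p h; exact (Hit.iteT he h).cast (by simp [cnt])
  | iteFalse c₁ c₂ he => intro k v p h; exact (Hit.iteF he h).cast (by simp [cnt])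

theorem out_hit {a : Chan} {v p} {x : Config} {α : Label} {y : Config} (h : Step x α y)
    (hα : α = .out a v p) : Hit a x.1 x.2 0 v p := by
  induction h with
  | seq c₂ _ ih => exact Hit.seq1 (ih hα)
  | out e b q σ => cases hα; exact Hit.out _ _ _
  | _ => cases hα

theorem proj_cons (a : Chan) (α : Label) (ls : List Label) :
    (projA a (α.consTo ls)).length = cnt a α + (projA a ls).length := by
  cases α with
  | silent => simp [Label.consTo, cnt]
  | out b v p =>
    by_cases h : b = a <;> simp [Label.consTo, cnt, projA, h, Nat.add_comm]

theorem steps_hit {a : Chan} {x : Config} {ls n y} (h : Steps x ls n y) :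
    ∀ k v p, Hit a y.1 y.2 k v p → Hit a x.1 x.2 ((projA a ls).length + k) v p := by
  induction h with
  | refl => intro k v p h; exact h.cast (by simp [projA])
  | step hs _ ih =>
    intro k v p h
    exact (step_hit hs _ _ _ (ih _ _ _ h)).cast (by rw [proj_cons]; omega)

theorem one_hit {a : Chan} {x y : Config} {v} (h : ProjSteps x a [v] 1 y) :
    ∃ p, Hit a x.1 x.2 0 v p := by
  obtain ⟨ls, h, hp⟩ := h
  cases h with
  | step hs h =>
    cases h
    rename_i α
    cases α with
    | silent => simp [Label.consTo, projA] at hp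
    | out b w p =>
      by_cases hb : b = a
      · subst hb
        simp [Label.consTo, projA] at hp
        subst hp
        exact ⟨p, out_hit hs rfl⟩
      · simp [Label.consTo, projA, hb] at hp

/-! ### Environments -/

/-- The program-counter update. -/
abbrev pcUp (e : Expr) : Env := Function.update idEnv .pc ({TVar.pc} ∪ fvT e)

theorem mem_comp {Γ₂ Γ₁ : Env} {x z} : z ∈ envComp Γ₂ Γ₁ x ↔ ∃ y ∈ Γ₂ x, z ∈ Γ₁ y := by
  simp [envComp]

theorem mem_pcUp {Γ : Env} {e : Expr} {x z} :
    z ∈ envComp Γ (pcUp e) x ↔ z ∈ Γ x ∨ (TVar.pc ∈ Γ x ∧ z ∈ fvT e) := by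
  rw [mem_comp]
  constructor
  · rintro ⟨y, hy, hz⟩
    by_cases h : y = .pc
    · subst h
      simp at hz
      rcases hz with rfl | hz
      · exact .inl hy
      · exact .inr ⟨hy, hz⟩
    · simp [h, idEnv] at hz
      subst hz
      exact .inl hy
  · rintro (h | ⟨h, h'⟩)
    · by_cases hz : z = .pc
      · subst hz; exact ⟨_, h, by simp⟩
      · exact ⟨_, h, by simp [hz, idEnv]⟩
    · exact ⟨_, h, by simp [h']⟩

/-- The while environment before resetting `pc`. -/
abbrev wEnv (e : Expr) (Γ : Env) : Env := envStar (envComp Γ (pcUp e))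

theorem w_refl (e Γ x) : x ∈ wEnv e Γ x := by
  simp only [wEnv, envStar, Set.mem_iUnion]; exact ⟨0, rfl⟩

theorem w_step {e Γ x y z} (hy : y ∈ wEnv e Γ x) (hz : z ∈ envComp Γ (pcUp e) y) :
    z ∈ wEnv e Γ x := by
  simp only [wEnv, envStar, Set.mem_iUnion] at *
  obtain ⟨n, hn⟩ := hy
  exact ⟨n + 1, mem_comp.2 ⟨y, hn, hz⟩⟩

theorem w_ind {e Γ x z} (hz : z ∈ wEnv e Γ x) (h : envComp Γ (pcUp e) x ⊆ {x}) : z = x := by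
  simp only [wEnv, envStar, Set.mem_iUnion] at hz
  obtain ⟨n, hn⟩ := hz
  induction n generalizing z with
  | zero => exact hn
  | succ n ih =>
    obtain ⟨y, hy, hz⟩ := mem_comp.1 hn
    have := ih hy
    subst this
    exact h hz

theorem ty_pc {c Γ} (h : Typing c Γ) : Γ .pc = {TVar.pc} := by
  induction h with
  | seq _ _ ih1 ih2 => ext z; simp [mem_comp, ih1, ih2]
  | _ => simp [idEnv]

theorem ty_nopc {c Γ} (h : Typing c Γ) : ∀ x, TVar.pc ∉ Γ x → Γ x = {x} := by
  induction h with
  | skip => intro x _; rfl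
  | assign y e =>
    intro x hx
    by_cases h : x = .pvar y
    · subst h; simp at hx
    · simp [h, idEnv]
  | seq h1 h2 ih1 ih2 =>
    intro x hx
    have hn2 : TVar.pc ∉ _ := fun h => hx (mem_comp.2 ⟨_, h, by rw [ty_pc h1]; rfl⟩)
    have e2 := ih2 x hn2
    have hn1 : TVar.pc ∉ _ := fun h => hx (mem_comp.2 ⟨x, by rw [e2]; rfl, h⟩)
    ext z; simp [mem_comp, e2, ih1 x hn1]
  | ite h1 h2 ih1 ih2 =>
    intro x hx
    by_cases h : x = .pc
    · subst h; simp
    · simp only [Function.update_of_ne h, envUnion, Set.mem_union, mem_pcUp, not_or] at hx ⊢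
      ext z
      simp only [Set.mem_union, mem_pcUp, ih1 x hx.1.1, ih2 x hx.2.1]
      have := hx.1.1; have := hx.2.1
      rw [ih1 x hx.1.1] at *
      simp; grind
  | whileT h ih =>
    intro x hx
    by_cases h : x = .pc
    · subst h; simp
    · rw [Function.update_of_ne h] at hx ⊢
      have hn : TVar.pc ∉ _ := fun h' => hx (w_step (w_refl _ _ x) (mem_pcUp.2 (.inl h')))
      apply Set.eq_singleton_iff_unique_mem.2
      refine ⟨w_refl _ _ x, fun z hz => w_ind hz ?_⟩
      intro z hz
      rcases mem_pcUp.1 hz with hz | hz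
      · rwa [ih x hn] at hz
      · exact absurd hz.1 hn
  | out e a p =>
    intro x hx
    by_cases h : x = .chan a
    · subst h; simp at hx
    · by_cases h' : x = .cpoint a p
      · subst h'; simp at hx
      · simp [h, h', idEnv]

theorem ty_refl {c Γ} (h : Typing c Γ) : ∀ x, (∀ y, x ≠ .pvar y) → x ∈ Γ x := by
  induction h with
  | skip => intro x _; rfl
  | assign y e => intro x hx; simp [hx y, idEnv]
  | seq h1 h2 ih1 ih2 => intro x hx; exact mem_comp.2 ⟨x, ih2 x hx, ih1 x hx⟩
  | ite h1 h2 ih1 ih2 =>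
    intro x hx
    by_cases h : x = .pc
    · subst h; simp
    · rw [Function.update_of_ne h]; exact .inl (mem_pcUp.2 (.inl (ih1 x hx)))
  | whileT h ih =>
    intro x hx
    by_cases h : x = .pc
    · subst h; simp
    · rw [Function.update_of_ne h]; exact w_refl _ _ x
  | out e a p =>
    intro x hx
    by_cases h : x = .chan a
    · subst h; simp
    · by_cases h' : x = .cpoint a p
      · subst h'; simp
      · simp [h, h', idEnv]

theorem ty_chan {c Γ} (h : Typing c Γ) : ∀ a p, TVar.pc ∈ Γ (.cpoint a p) →
    TVar.chan a ∈ Γ (.cpoint a p) := by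
  induction h with
  | skip => intro a p h; simp [idEnv] at h
  | assign y e => intro a p h; simp [idEnv] at h
  | seq h1 h2 ih1 ih2 =>
    intro a p h
    rename_i Γ₁ _ Γ₂
    by_cases hn : TVar.pc ∈ Γ₂ (.cpoint a p)
    · exact mem_comp.2 ⟨_, ih2 a p hn, ty_refl h1 _ (by simp)⟩
    · have e2 := ty_nopc h2 _ hn
      obtain ⟨y, hy, h⟩ := mem_comp.1 h
      rw [e2] at hy
      cases hy
      exact mem_comp.2 ⟨_, by rw [e2]; rfl, ih1 a p h⟩
  | ite h1 h2 ih1 ih2 =>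
    intro a p h
    rw [Function.update_of_ne (by simp)] at h ⊢
    simp only [envUnion, Set.mem_union, mem_pcUp] at h ⊢
    grind
  | whileT h ih =>
    intro a p hp
    rename_i Γc
    rw [Function.update_of_ne (by simp)] at hp ⊢
    by_cases hn : TVar.pc ∈ Γc (.cpoint a p)
    · exact w_step (w_refl _ _ _) (mem_pcUp.2 (.inl (ih a p hn)))
    · exfalso
      have := w_ind hp (fun z hz => by
        rcases mem_pcUp.1 hz with hz | hz
        · rwa [ty_nopc h _ hn] at hz
        · exact absurd hz.1 hn)
      cases this
  | out e b q =>
    intro a p h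
    by_cases h' : TVar.cpoint a p = .cpoint b q
    · cases h'; simp
    · rw [Function.update_of_ne (by simp), Function.update_of_ne h'] at h
      simp [idEnv] at h

/-- Everything a command affects depends on `pc`. -/
theorem ty_eff {c Γ} (h : Typing c Γ) (a : Chan) :
    (∀ σ k σ', Term a c σ k σ' →
      (∀ x, TVar.pc ∉ Γ (.pvar x) → σ' x = σ x) ∧ (TVar.pc ∉ Γ (.chan a) → k = 0)) ∧
    (∀ σ k v p, Hit a c σ k v p → TVar.pc ∈ Γ (.chan a) ∧ TVar.pc ∈ Γ (.cpoint a p)) := by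
  induction h with
  | skip =>
    refine ⟨?_, ?_⟩
    · intro σ k σ' h; cases h; simp
    · intro σ k v p h; cases h
  | assign y e =>
    refine ⟨?_, ?_⟩
    · intro σ k σ' h; cases h
      refine ⟨fun x hx => ?_, fun _ => rfl⟩
      by_cases h : x = y
      · subst h; simp at hx
      · simp [h]
    · intro σ k v p h; cases h
  | out e b q =>
    refine ⟨?_, ?_⟩
    · intro σ k σ' h; cases h
      refine ⟨fun x hx => rfl, fun hx => ?_⟩
      by_cases h : b = a
      · subst h; simp at hx
      · simp [h]
    · intro σ k v p h; cases h; simp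
  | seq h1 h2 ih1 ih2 =>
    rename_i c₁ Γ₁ c₂ Γ₂
    have P2 : ∀ x, TVar.pc ∈ Γ₂ x → TVar.pc ∈ envComp Γ₂ Γ₁ x := fun x h =>
      mem_comp.2 ⟨_, h, by rw [ty_pc h1]; rfl⟩
    have P1 : ∀ x, TVar.pc ∈ Γ₁ x → TVar.pc ∈ envComp Γ₂ Γ₁ x := fun x h => by
      by_cases hn : TVar.pc ∈ Γ₂ x
      · exact P2 x hn
      · exact mem_comp.2 ⟨x, by rw [ty_nopc h2 _ hn]; rfl, h⟩
    refine ⟨?_, ?_⟩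
    · intro σ k σ' h
      cases h with
      | seq t1 t2 =>
        have A := ih1.1 _ _ _ t1
        have B := ih2.1 _ _ _ t2
        refine ⟨fun x hx => ?_, fun hx => ?_⟩
        · rw [B.1 x (fun h => hx (P2 _ h)), A.1 x (fun h => hx (P1 _ h))]
        · rw [B.2 (fun h => hx (P2 _ h)), A.2 (fun h => hx (P1 _ h))]
    · intro σ k v p h
      cases h with
      | seq1 h => have := ih1.2 _ _ _ _ h; exact ⟨P1 _ this.1, P1 _ this.2⟩
      | seq2 _ h => have := ih2.2 _ _ _ _ h; exact ⟨P2 _ this.1, P2 _ this.2⟩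
  | ite h1 h2 ih1 ih2 =>
    simp only [ne_eq, reduceCtorEq, not_false_eq_true, Function.update_of_ne, envUnion,
      Set.mem_union, mem_pcUp, not_or]
    refine ⟨?_, ?_⟩
    · intro σ k σ' h
      cases h with
      | iteT _ h =>
        exact ⟨fun x hx => (ih1.1 _ _ _ h).1 x hx.1.1, fun hx => (ih1.1 _ _ _ h).2 hx.1.1⟩
      | iteF _ h =>
        exact ⟨fun x hx => (ih2.1 _ _ _ h).1 x hx.2.1, fun hx => (ih2.1 _ _ _ h).2 hx.2.1⟩
    · intro σ k v p h
      cases h with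
      | iteT _ h => have := ih1.2 _ _ _ _ h; exact ⟨.inl (.inl this.1), .inl (.inl this.2)⟩
      | iteF _ h => have := ih2.2 _ _ _ _ h; exact ⟨.inr (.inl this.1), .inr (.inl this.2)⟩
  | whileT h ih =>
    rename_i e c Γc
    simp only [ne_eq, reduceCtorEq, not_false_eq_true, Function.update_of_ne]
    have P : ∀ x, TVar.pc ∈ Γc x → TVar.pc ∈ wEnv e Γc x := fun x h =>
      w_step (w_refl _ _ x) (mem_pcUp.2 (.inl h))
    refine ⟨?_, ?_⟩
    · intro σ k σ' h
      generalize hw : Cmd.while e c = w at h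
      induction h with
      | whileF _ => exact ⟨fun _ _ => rfl, fun _ => rfl⟩
      | whileT _ t1 t2 _ ih2 =>
        cases hw
        have A := ih.1 _ _ _ t1
        have B := ih2 rfl
        refine ⟨fun x hx => ?_, fun hx => ?_⟩
        · rw [B.1 x hx, A.1 x (fun h => hx (P _ h))]
        · rw [B.2 hx, A.2 (fun h => hx (P _ h))]
      | _ => cases hw
    · intro σ k v p h
      generalize hw : Cmd.while e c = w at h
      induction h with
      | while1 _ h => cases hw; have := ih.2 _ _ _ _ h; exact ⟨P _ this.1, P _ this.2⟩
      | while2 _ _ _ ih2 => exact ih2 hw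
      | _ => cases hw

theorem eval_congr {e : Expr} {σ ρ : Store} (h : ∀ y, TVar.pvar y ∈ fvT e → σ y = ρ y) :
    e.eval σ = e.eval ρ := by
  cases e with
  | const v => rfl
  | var x => exact h x (by simp [fvT, Expr.fv])

/-- Semantic soundness of an environment for a command. -/
structure Snd (a : Chan) (c : Cmd) (Γ : Env) : Prop where
  tv : ∀ {σ ρ k j σ' ρ'}, Term a c σ k σ' → Term a c ρ j ρ' →
    ∀ x, eqG Γ (.pvar x) σ ρ → σ' x = ρ' x
  tc : ∀ {σ ρ k j σ' ρ'}, Term a c σ k σ' → Term a c ρ j ρ' → eqG Γ (.chan a) σ ρ → k = j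
  th : ∀ {σ ρ k j σ' v p}, Term a c σ k σ' → Hit a c ρ j v p → eqG Γ (.chan a) σ ρ → j < k
  ht : ∀ {σ ρ k j ρ' v p}, Hit a c σ k v p → Term a c ρ j ρ' → eqG Γ (.cpoint a p) σ ρ → k < j
  hh : ∀ {σ ρ k v v' p p'}, Hit a c σ k v p → Hit a c ρ k v' p' → eqG Γ (.cpoint a p) σ ρ → v = v'

theorem eqG_symm {Γ x σ ρ} (h : eqG Γ x σ ρ) : eqG Γ x ρ σ := fun y hy => (h y hy).symm

theorem eqG_comp {Γ₂ Γ₁ : Env} {x y σ ρ} (h : eqG (envComp Γ₂ Γ₁) x σ ρ) (hy : y ∈ Γ₂ x) :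
    eqG Γ₁ y σ ρ := fun z hz => h z (mem_comp.2 ⟨y, hy, hz⟩)

theorem snd_seq {a c₁ c₂ Γ₁ Γ₂} (h2 : Typing c₂ Γ₂)
    (s1 : Snd a c₁ Γ₁) (s2 : Snd a c₂ Γ₂) : Snd a (.seq c₁ c₂) (envComp Γ₂ Γ₁) := by
  have mid : ∀ {x σ ρ k j σ' ρ'}, eqG (envComp Γ₂ Γ₁) x σ ρ → Term a c₁ σ k σ' →
      Term a c₁ ρ j ρ' → eqG Γ₂ x σ' ρ' := fun h t t' y hy => s1.tv t t' y (eqG_comp h hy)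
  have hca : TVar.chan a ∈ Γ₂ (.chan a) := ty_refl h2 _ (by simp)
  have hcp : ∀ p, TVar.cpoint a p ∈ Γ₂ (.cpoint a p) := fun p => ty_refl h2 _ (by simp)
  have hc : ∀ {σ k v p}, Hit a c₂ σ k v p → TVar.chan a ∈ Γ₂ (.cpoint a p) := fun h =>
    ty_chan h2 _ _ ((ty_eff h2 a).2 _ _ _ _ h).2
  constructor
  · intro σ ρ k j σ' ρ' t t' x hx
    cases t with
    | seq t1 t2 => cases t' with
      | seq u1 u2 => exact s2.tv t2 u2 x (mid hx t1 u1)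
  · intro σ ρ k j σ' ρ' t t' hx
    cases t with
    | seq t1 t2 => cases t' with
      | seq u1 u2 => rw [s2.tc t2 u2 (mid hx t1 u1), s1.tc t1 u1 (eqG_comp hx hca)]
  · intro σ ρ k j σ' v p t t' hx
    cases t with
    | seq t1 t2 => cases t' with
      | seq1 u => have := s1.th t1 u (eqG_comp hx hca); omega
      | seq2 u1 u2 =>
        have := s1.tc t1 u1 (eqG_comp hx hca)
        have := s2.th t2 u2 (mid hx t1 u1)
        omega
  · intro σ ρ k j ρ' v p t t' hx
    cases t' with
    | seq u1 u2 => cases t with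
      | seq1 t => have := s1.ht t u1 (eqG_comp hx (hcp _)); omega
      | seq2 t1 t2 =>
        have := s1.tc t1 u1 (eqG_comp hx (hc t2))
        have := s2.ht t2 u2 (mid hx t1 u1)
        omega
  · intro σ ρ k v v' p p' t t' hx
    generalize hk : k = k' at t'
    cases t with
    | seq1 t => cases t' with
      | seq1 u => subst hk; exact s1.hh t u (eqG_comp hx (hcp _))
      | seq2 u1 u2 => have := s1.ht t u1 (eqG_comp hx (hcp _)); omega
    | seq2 t1 t2 => cases t' with
      | seq1 u => have := s1.th t1 u (eqG_comp hx (hc t2)); omega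
      | seq2 u1 u2 =>
        have := s1.tc t1 u1 (eqG_comp hx (hc t2))
        have : _ = _ := Nat.add_left_cancel (this ▸ hk)
        subst this
        exact s2.hh t2 u2 (mid hx t1 u1)

theorem snd_ite {a c₁ c₂ Γ₁ Γ₂ e Γ} (h1 : Typing c₁ Γ₁) (h2 : Typing c₂ Γ₂)
    (hT : Typing (.ite e c₁ c₂) Γ)
    (s1 : Snd a c₁ Γ₁) (s2 : Snd a c₂ Γ₂)
    (g1 : ∀ x, x ≠ .pc → Γ₁ x ⊆ Γ x) (g2 : ∀ x, x ≠ .pc → Γ₂ x ⊆ Γ x)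
    (g : ∀ x, x ≠ .pc → TVar.pc ∈ Γ x → fvT e ⊆ Γ x) : Snd a (.ite e c₁ c₂) Γ := by
  have ev : ∀ {x σ ρ}, x ≠ .pc → TVar.pc ∈ Γ x → eqG Γ x σ ρ → e.eval σ = e.eval ρ :=
    fun hx hp h => eval_congr fun y hy => h y (g _ hx hp hy)
  have m1 : ∀ {x σ ρ}, x ≠ .pc → eqG Γ x σ ρ → eqG Γ₁ x σ ρ := fun hx h y hy => h y (g1 _ hx hy)
  have m2 : ∀ {x σ ρ}, x ≠ .pc → eqG Γ x σ ρ → eqG Γ₂ x σ ρ := fun hx h y hy => h y (g2 _ hx hy)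
  constructor
  · intro σ ρ k j σ' ρ' t t' x hx
    by_cases hp : TVar.pc ∈ Γ (.pvar x)
    · have E := ev (by simp) hp hx
      cases t with
      | iteT ht t => cases t' with
        | iteT hu u => exact s1.tv t u x (m1 (by simp) hx)
        | iteF hu u => exact absurd (E.trans hu) ht
      | iteF ht t => cases t' with
        | iteT hu u => exact absurd (E.symm.trans ht) hu
        | iteF hu u => exact s2.tv t u x (m2 (by simp) hx)
    · rw [((ty_eff hT a).1 _ _ _ t).1 x hp, ((ty_eff hT a).1 _ _ _ t').1 x hp]
      exact hx x (by rw [ty_nopc hT _ hp]; rfl)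
  · intro σ ρ k j σ' ρ' t t' hx
    by_cases hp : TVar.pc ∈ Γ (.chan a)
    · have E := ev (by simp) hp hx
      cases t with
      | iteT ht t => cases t' with
        | iteT hu u => exact s1.tc t u (m1 (by simp) hx)
        | iteF hu u => exact absurd (E.trans hu) ht
      | iteF ht t => cases t' with
        | iteT hu u => exact absurd (E.symm.trans ht) hu
        | iteF hu u => exact s2.tc t u (m2 (by simp) hx)
    · rw [((ty_eff hT a).1 _ _ _ t).2 hp, ((ty_eff hT a).1 _ _ _ t').2 hp]
  · intro σ ρ k j σ' v p t t' hx
    have E := ev (by simp) ((ty_eff hT a).2 _ _ _ _ t').1 hx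
    cases t with
    | iteT ht t => cases t' with
      | iteT hu u => exact s1.th t u (m1 (by simp) hx)
      | iteF hu u => exact absurd (E.trans hu) ht
    | iteF ht t => cases t' with
      | iteT hu u => exact absurd (E.symm.trans ht) hu
      | iteF hu u => exact s2.th t u (m2 (by simp) hx)
  · intro σ ρ k j ρ' v p t t' hx
    have E := ev (by simp) ((ty_eff hT a).2 _ _ _ _ t).2 hx
    cases t with
    | iteT ht t => cases t' with
      | iteT hu u => exact s1.ht t u (m1 (by simp) hx)
      | iteF hu u => exact absurd (E.trans hu) ht
    | iteF ht t => cases t' with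
      | iteT hu u => exact absurd (E.symm.trans ht) hu
      | iteF hu u => exact s2.ht t u (m2 (by simp) hx)
  · intro σ ρ k v v' p p' t t' hx
    have E := ev (by simp) ((ty_eff hT a).2 _ _ _ _ t).2 hx
    cases t with
    | iteT ht t => cases t' with
      | iteT hu u => exact s1.hh t u (m1 (by simp) hx)
      | iteF hu u => exact absurd (E.trans hu) ht
    | iteF ht t => cases t' with
      | iteT hu u => exact absurd (E.symm.trans ht) hu
      | iteF hu u => exact s2.hh t u (m2 (by simp) hx)

theorem snd_while {a c Γc e Γ} (hT : Typing (.while e c) Γ) (s : Snd a c Γc)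
    (gr : ∀ x, x ≠ .pc → x ∈ Γ x)
    (gs : ∀ x y z, x ≠ .pc → y ∈ Γ x → z ∈ Γc y → z ∈ Γ x)
    (g : ∀ x, x ≠ .pc → TVar.pc ∈ Γ x → fvT e ⊆ Γ x) : Snd a (.while e c) Γ := by
  have ev : ∀ {x σ ρ}, x ≠ .pc → TVar.pc ∈ Γ x → eqG Γ x σ ρ → e.eval σ = e.eval ρ :=
    fun hx hp h => eval_congr fun y hy => h y (g _ hx hp hy)
  have sub : ∀ {x y σ ρ}, x ≠ .pc → y ∈ Γ x → eqG Γ x σ ρ → eqG Γc y σ ρ :=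
    fun hx hy h z hz => h z (gs _ _ _ hx hy hz)
  have mid : ∀ {x σ ρ k j σ' ρ'}, x ≠ .pc → eqG Γ x σ ρ → Term a c σ k σ' →
      Term a c ρ j ρ' → eqG Γ x σ' ρ' := fun hx h t t' y hy => s.tv t t' y (sub hx hy h)
  constructor
  · intro σ ρ k j σ' ρ' t t' x hx
    by_cases hp : TVar.pc ∈ Γ (.pvar x)
    · generalize hw : Cmd.while e c = w at t
      induction t generalizing ρ j with
      | whileF h =>
        cases hw
        cases t' with
        | whileF h' => exact hx x (gr _ (by simp))
        | whileT h' _ _ => exact absurd ((ev (by simp) hp hx).symm.trans h) h'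
      | whileT h t1 t2 _ ih =>
        cases hw
        cases t' with
        | whileF h' => exact absurd ((ev (by simp) hp hx).trans h') h
        | whileT h' u1 u2 => exact ih u2 (mid (by simp) hx t1 u1) rfl
      | _ => cases hw
    · rw [((ty_eff hT a).1 _ _ _ t).1 x hp, ((ty_eff hT a).1 _ _ _ t').1 x hp]
      exact hx x (by rw [ty_nopc hT _ hp]; rfl)
  · intro σ ρ k j σ' ρ' t t' hx
    by_cases hp : TVar.pc ∈ Γ (.chan a)
    · generalize hw : Cmd.while e c = w at t
      induction t generalizing ρ j with
      | whileF h =>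
        cases hw
        cases t' with
        | whileF h' => rfl
        | whileT h' _ _ => exact absurd ((ev (by simp) hp hx).symm.trans h) h'
      | whileT h t1 t2 _ ih =>
        cases hw
        cases t' with
        | whileF h' => exact absurd ((ev (by simp) hp hx).trans h') h
        | whileT h' u1 u2 =>
          rw [ih u2 (mid (by simp) hx t1 u1) rfl, s.tc t1 u1 (sub (by simp) (gr _ (by simp)) hx)]
      | _ => cases hw
    · rw [((ty_eff hT a).1 _ _ _ t).2 hp, ((ty_eff hT a).1 _ _ _ t').2 hp]
  · intro σ ρ k j σ' v p t t' hx
    have hp := ((ty_eff hT a).2 _ _ _ _ t').1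
    generalize hw : Cmd.while e c = w at t
    induction t generalizing ρ j with
    | whileF h =>
      cases hw
      have E := (ev (by simp) hp hx).symm.trans h
      cases t' with
      | while1 h' _ => exact absurd E h'
      | while2 h' _ _ => exact absurd E h'
    | whileT h t1 t2 _ ih =>
      cases hw
      cases t' with
      | while1 h' u =>
        have := s.th t1 u (sub (by simp) (gr _ (by simp)) hx); omega
      | while2 h' u1 u2 =>
        have := ih u2 (mid (by simp) hx t1 u1) rfl
        have := s.tc t1 u1 (sub (by simp) (gr _ (by simp)) hx)
        omega
    | _ => cases hw
  · intro σ ρ k j ρ' v p t t' hx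
    have hp := ((ty_eff hT a).2 _ _ _ _ t).2
    have hc := ty_chan hT _ _ hp
    generalize hw : Cmd.while e c = w at t
    induction t generalizing ρ j with
    | while1 h t =>
      cases hw
      cases t' with
      | whileF h' => exact absurd ((ev (by simp) hp hx).trans h') h
      | whileT h' u1 u2 =>
        have := s.ht t u1 (sub (by simp) (gr _ (by simp)) hx); omega
    | while2 h t1 t2 ih =>
      cases hw
      cases t' with
      | whileF h' => exact absurd ((ev (by simp) hp hx).trans h') h
      | whileT h' u1 u2 =>
        have := ih u2 (mid (by simp) hx t1 u1) hp hc rfl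
        have := s.tc t1 u1 (sub (by simp) hc hx)
        omega
    | _ => cases hw
  · intro σ ρ k v v' p p' t t' hx
    have hp := ((ty_eff hT a).2 _ _ _ _ t).2
    have hc := ty_chan hT _ _ hp
    generalize hw : Cmd.while e c = w at t
    induction t generalizing ρ with
    | while1 h t =>
      cases hw
      rename_i k _ _
      generalize hk : k = k' at t'
      cases t' with
      | while1 h' u => subst hk; exact s.hh t u (sub (by simp) (gr _ (by simp)) hx)
      | while2 h' u1 u2 =>
        have := s.ht t u1 (sub (by simp) (gr _ (by simp)) hx); omega
    | while2 h t1 t2 ih =>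
      cases hw
      generalize hk : (_ + _ : ℕ) = k' at t'
      cases t' with
      | while1 h' u =>
        have := s.th t1 u (sub (by simp) hc hx); omega
      | while2 h' u1 u2 =>
        have := s.tc t1 u1 (sub (by simp) hc hx)
        have : _ = _ := Nat.add_left_cancel (this ▸ hk)
        subst this
        exact ih u2 (mid (by simp) hx t1 u1) hp hc rfl
    | _ => cases hw

theorem snd_all {c Γ} (h : Typing c Γ) (a : Chan) : Snd a c Γ := by
  induction h with
  | skip =>
    constructor
    · intro σ ρ k j σ' ρ' t t' x hx; cases t; cases t'; exact hx x rfl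
    · intro σ ρ k j σ' ρ' t t' hx; cases t; cases t'; rfl
    · intro σ ρ k j σ' v p t t' hx; cases t'
    · intro σ ρ k j ρ' v p t t' hx; cases t
    · intro σ ρ k v v' p p' t t' hx; cases t
  | assign y e =>
    constructor
    · intro σ ρ k j σ' ρ' t t' x hx
      cases t; cases t'
      by_cases h : x = y
      · subst h
        simp only [Function.update_self]
        exact eval_congr fun z hz => hx z (by simp [hz])
      · simp only [Function.update_of_ne h]
        exact hx x (by simp [h, idEnv])
    · intro σ ρ k j σ' ρ' t t' hx; cases t; cases t'; rfl
    · intro σ ρ k j σ' v p t t' hx; cases t'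
    · intro σ ρ k j ρ' v p t t' hx; cases t
    · intro σ ρ k v v' p p' t t' hx; cases t
  | out e b q =>
    constructor
    · intro σ ρ k j σ' ρ' t t' x hx; cases t; cases t'; exact hx x (by simp [idEnv])
    · intro σ ρ k j σ' ρ' t t' hx; cases t; cases t'; rfl
    · intro σ ρ k j σ' v p t t' hx; cases t'; cases t; simp
    · intro σ ρ k j ρ' v p t t' hx; cases t; cases t'; simp
    · intro σ ρ k v v' p p' t t' hx
      cases t; cases t'
      exact eval_congr fun z hz => hx z (by simp [hz])
  | seq h1 h2 ih1 ih2 => exact snd_seq h2 ih1 ih2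
  | ite h1 h2 ih1 ih2 =>
    refine snd_ite h1 h2 (Typing.ite h1 h2) ih1 ih2 ?_ ?_ ?_
    · intro x hx z hz
      rw [Function.update_of_ne hx]; exact .inl (mem_pcUp.2 (.inl hz))
    · intro x hx z hz
      rw [Function.update_of_ne hx]; exact .inr (mem_pcUp.2 (.inl hz))
    · intro x hx hp z hz
      rw [Function.update_of_ne hx] at hp ⊢
      simp only [envUnion, Set.mem_union, mem_pcUp] at hp ⊢
      grind
  | whileT h ih =>
    refine snd_while (Typing.whileT h) ih ?_ ?_ ?_
    · intro x hx; rw [Function.update_of_ne hx]; exact w_refl _ _ x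
    · intro x y z hx hy hz
      rw [Function.update_of_ne hx] at hy ⊢
      exact w_step hy (mem_pcUp.2 (.inl hz))
    · intro x hx hp z hz
      rw [Function.update_of_ne hx] at hp ⊢
      exact w_step hp (mem_pcUp.2 (.inr ⟨by rw [ty_pc h]; rfl, hz⟩))

end Helpers

/-- soundness of the dependency type system. -/
theorem typing_sound {c : Cmd} {Γ : Env} (hty : Typing c Γ) :
    ∀ (σ ρ : Store) (t t' : List Val) (n m : ℕ) (cσ cρ : Cmd) (σ' ρ' : Store)
      (a : Chan) (v v' : Val) (p : PPoint) (cfg cfg' : Config),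
      ProjSteps (c, σ) a t n (cσ, σ') → Step (cσ, σ') (.out a v p) cfg →
      ProjSteps (c, ρ) a t' m (cρ, ρ') → ProjSteps (cρ, ρ') a [v'] 1 cfg' →
      t.length = t'.length → eqG Γ (.cpoint a p) σ ρ → v = v' := by
  intro σ ρ t t' n m cσ cρ σ' ρ' a v v' p cfg cfg' h1 h2 h3 h4 hl hx
  obtain ⟨ls, h1, rfl⟩ := h1
  obtain ⟨ls', h3, rfl⟩ := h3
  obtain ⟨p', h4⟩ := one_hit h4
  have A := steps_hit h1 _ _ _ (out_hit h2 rfl)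
  have B := steps_hit h3 _ _ _ h4
  rw [← hl] at B
  exact (snd_all hty a).hh A B hx
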